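/- Let (W,S) be a finite Coxeter system. For J ⊆ S and k ≥ 1, let N_σ(J,k) denote the number of k-chains u₁ ≤_σ u₂ ≤_σ … ≤_σ u_k in the shard order on W whose top element u_k has support equal to J. Then for every k ≥ 2 and every J ⊆ S, N_σ(J,k) = Σ_{I ⊆ J} #E_σ(I,J) · N_σ(I,k−1). -/

import Mathlib

open scoped Classical

namespace ShardBHZ

variable {B : Type*} {W : Type*} [Group W] {M : CoxeterMatrix B} (cs : CoxeterSystem M W)

/-- The support `S(w)` of `w`: the set of simple reflections appearing in some
(equivalently, any) reduced word for `w`. -/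
def supp (w : W) : Set B := {i | ∃ l : List B, cs.IsReduced l ∧ cs.wordProd l = w ∧ i ∈ l}

/-- The standard parabolic subgroup `W_I` generated by the simple reflections in `I`. -/
def parab (I : Set B) : Subgroup W := Subgroup.closure (cs.simple '' I)

/-- `x` has no right descent in `I`; this characterizes the minimal length coset
representatives `W^I` of `W / W_I`. -/
def IsMinRep (I : Set B) (x : W) : Prop := ∀ i ∈ I, ¬ cs.IsRightDescent x i

/-- The BHZ order: `u ≤_β v` iff the parabolic component `v_{S(u)}` equals `u`, i.e.
`v = (v * u⁻¹) * u` is the parabolic factorization of `v` with respect to `W_{S(u)}`: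
`u ∈ W_{S(u)}`, `v * u⁻¹` has no right descent in `S(u)`, and lengths add. -/
def bhzLE (u v : W) : Prop :=
  u ∈ parab cs (supp cs u) ∧ IsMinRep cs (supp cs u) (v * u⁻¹) ∧
    cs.length v = cs.length (v * u⁻¹) + cs.length u

/-- The set `N(w)` of left inversions of `w`. -/
def invSet (w : W) : Set W := {t | cs.IsLeftInversion w t}

/-- The subgroup `G(w)` generated by `w * s * w⁻¹` for `s` a right descent of `w`. -/
def descConj (w : W) : Subgroup W :=
  Subgroup.closure {x | ∃ i, cs.IsRightDescent w i ∧ x = w * cs.simple i * w⁻¹}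

/-- The shard intersection order: `u ≤_σ v` iff `N(u) ⊆ N(v)` and `G(u) ⊆ G(v)`. -/
def shardLE (u v : W) : Prop := invSet cs u ⊆ invSet cs v ∧ descConj cs u ≤ descConj cs v

/-- `E_β(I,J) = {u ∈ W_J : u has no right descent in I and J \ I ⊆ S(u)}`. -/
def Eb (I J : Set B) : Set W :=
  {u | u ∈ parab cs J ∧ IsMinRep cs I u ∧ J \ I ⊆ supp cs u}

/-- `E_σ(I,J) = {w ∈ W_J : S(w) = J and I ⊆ D_R(w) ⊆ J}`. -/
def Es (I J : Set B) : Set W :=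
  {w | w ∈ parab cs J ∧ supp cs w = J ∧ (∀ i ∈ I, cs.IsRightDescent w i) ∧
    ∀ i : B, cs.IsRightDescent w i → i ∈ J}

/-- The number of `(k+1)`-chains for the relation `r` whose top element has
support `J`. -/
noncomputable def nchainsTop (r : W → W → Prop) (k : ℕ) (J : Set B) : ℕ :=
  Nat.card {c : Fin (k + 1) → W //
    (∀ i j : Fin (k + 1), i ≤ j → r (c i) (c j)) ∧ supp cs (c (Fin.last k)) = J}

/-- The action of a simple reflection on pairs of a group element and a sign. -/
noncomputable def signedConj (i : B) : Equiv.Perm (W × ZMod 2) where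
  toFun p := (cs.simple i * p.1 * cs.simple i, p.2 + if p.1 = cs.simple i then 1 else 0)
  invFun p := (cs.simple i * p.1 * cs.simple i, p.2 + if p.1 = cs.simple i then 1 else 0)
  left_inv p := by
    have h : cs.simple i * p.1 * cs.simple i = cs.simple i ↔ p.1 = cs.simple i := by
      constructor
      · intro h
        have := congrArg (fun y ↦ cs.simple i * y * cs.simple i) h
        simpa [mul_assoc] using this
      · intro h; simp [h]
    ext
    · simp [mul_assoc]
    · simp only [h, add_assoc, CharTwo.add_self_eq_zero, add_zero]
  right_inv p := by
    have h : cs.simple i * p.1 * cs.simple i = cs.simple i ↔ p.1 = cs.simple i := by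
      constructor
      · intro h
        have := congrArg (fun y ↦ cs.simple i * y * cs.simple i) h
        simpa [mul_assoc] using this
      · intro h; simp [h]
    ext
    · simp [mul_assoc]
    · simp only [h, add_assoc, CharTwo.add_self_eq_zero, add_zero]

theorem prod_signedConj_apply (ω : List B) (p : W × ZMod 2) :
    (ω.map (signedConj cs)).prod p =
      (cs.wordProd ω * p.1 * (cs.wordProd ω)⁻¹, p.2 + (cs.rightInvSeq ω).count p.1) := by
  induction ω with
  | nil => simp
  | cons i ω ih =>
    have h : cs.wordProd ω * p.1 * (cs.wordProd ω)⁻¹ = cs.simple i ↔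
        (cs.wordProd ω)⁻¹ * cs.simple i * cs.wordProd ω = p.1 := by
      constructor
      · intro h; rw [← h]; group
      · intro h; rw [← h]; group
    rw [List.map_cons, List.prod_cons, Equiv.Perm.mul_apply, ih]
    ext
    · simp [signedConj, cs.wordProd_cons, mul_assoc]
    · simp only [signedConj, Equiv.coe_fn_mk, CoxeterSystem.rightInvSeq, List.count_cons, h,
        beq_iff_eq, Nat.cast_add, Nat.cast_ite, Nat.cast_one, Nat.cast_zero, add_assoc]

theorem even_count_leftInvSeq_alternatingWord (i j : B) (t : W) :
    Even ((cs.leftInvSeq (CoxeterSystem.alternatingWord i j (2 * M i j))).count t) := by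
  set L := cs.leftInvSeq (CoxeterSystem.alternatingWord i j (2 * M i j)) with hL
  have hlen : L.length = 2 * M i j := by simp [hL]
  have h : L.take (M i j) = L.drop (M i j) := by
    apply List.ext_getElem
    · simp [hlen]; lia
    · intro n h₁ h₂
      simp only [List.length_take, hlen] at h₁
      rw [List.getElem_take, List.getElem_drop]
      simp only [hL]
      rw [cs.getElem_leftInvSeq_alternatingWord _ _ _ _ (by lia),
        cs.getElem_leftInvSeq_alternatingWord _ _ _ _ (by lia),
        cs.prod_alternatingWord_eq_mul_pow, cs.prod_alternatingWord_eq_mul_pow]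
      have e₁ : (2 * n + 1) / 2 = n := by lia
      have e₂ : (2 * (M i j + n) + 1) / 2 = M i j + n := by lia
      have e₃ : (cs.simple j * cs.simple i) ^ M i j = 1 := by
        rw [M.symmetric]; exact cs.simple_mul_simple_pow j i
      simp [e₁, e₂, pow_add, e₃]
  rw [← List.take_append_drop (M i j) L, List.count_append, h]
  exact Even.add_self _

theorem isLiftable_signedConj : M.IsLiftable (signedConj cs) := by
  intro i j
  have key : ∀ n, (((CoxeterSystem.alternatingWord i j (2 * n))).map (signedConj cs)).prod =
      (signedConj cs i * signedConj cs j) ^ n := by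
    intro n
    induction n with
    | zero => simp [CoxeterSystem.alternatingWord]
    | succ n ih =>
      rw [pow_succ, ← ih, show 2 * (n + 1) = 2 * n + 1 + 1 by ring]
      simp [CoxeterSystem.alternatingWord]
  rw [← key]
  ext1 p
  have h₁ : cs.wordProd (CoxeterSystem.alternatingWord i j (2 * M i j)) = 1 := by
    simp [cs.prod_alternatingWord_eq_mul_pow]
  have h₂ : (((cs.rightInvSeq (CoxeterSystem.alternatingWord i j (2 * M i j))).count p.1 : ℕ) :
      ZMod 2) = 0 := by
    have h : ∀ n, (CoxeterSystem.alternatingWord i j (2 * n)).reverse =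
        CoxeterSystem.alternatingWord j i (2 * n) := by
      intro n
      induction n with
      | zero => rfl
      | succ n ih =>
        rw [show 2 * (n + 1) = 2 * n + 1 + 1 by ring, CoxeterSystem.alternatingWord_succ' j i,
          CoxeterSystem.alternatingWord_succ' j i]
        simp [CoxeterSystem.alternatingWord, ih]
    rw [ZMod.natCast_eq_zero_iff_even, ← List.count_reverse, ← cs.leftInvSeq_reverse, h,
      M.symmetric]
    exact even_count_leftInvSeq_alternatingWord cs j i p.1
  rw [prod_signedConj_apply, h₁, h₂]
  simp

/-- The action of `W` on pairs of a group element and a sign. -/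
noncomputable def signedConjHom : W →* Equiv.Perm (W × ZMod 2) :=
  cs.lift ⟨signedConj cs, isLiftable_signedConj cs⟩

theorem signedConjHom_wordProd (ω : List B) (p : W × ZMod 2) :
    signedConjHom cs (cs.wordProd ω) p =
      (cs.wordProd ω * p.1 * (cs.wordProd ω)⁻¹, p.2 + (cs.rightInvSeq ω).count p.1) := by
  rw [← prod_signedConj_apply, CoxeterSystem.wordProd, map_list_prod, List.map_map]
  congr 3
  funext i
  exact cs.lift_apply_simple (isLiftable_signedConj cs) i

/-- The parity of the number of occurrences of `t` in a right inversion sequence of `w`. -/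
noncomputable def invParity (w t : W) : ZMod 2 := (signedConjHom cs w (t, 0)).2

theorem invParity_wordProd (ω : List B) (t : W) :
    invParity cs (cs.wordProd ω) t = (cs.rightInvSeq ω).count t := by
  simp [invParity, signedConjHom_wordProd]

theorem signedConjHom_apply (w t : W) (e : ZMod 2) :
    signedConjHom cs w (t, e) = (w * t * w⁻¹, e + invParity cs w t) := by
  obtain ⟨ω, rfl⟩ := cs.wordProd_surjective w
  rw [invParity_wordProd, signedConjHom_wordProd]

theorem invParity_mul (u v t : W) :
    invParity cs (u * v) t = invParity cs v t + invParity cs u (v * t * v⁻¹) := by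
  rw [invParity, map_mul, Equiv.Perm.mul_apply, signedConjHom_apply, signedConjHom_apply, zero_add]

theorem invParity_one (t : W) : invParity cs 1 t = 0 := by
  simp [invParity]

theorem invParity_self {t : W} (ht : cs.IsReflection t) : invParity cs t t = 1 := by
  obtain ⟨w, i, rfl⟩ := ht
  have h₁ : invParity cs (cs.simple i) (cs.simple i) = 1 := by
    simpa using invParity_wordProd cs [i] (cs.simple i)
  have h₂ := invParity_mul cs w w⁻¹ (w * cs.simple i * w⁻¹)
  rw [mul_inv_cancel, invParity_one] at h₂
  rw [invParity_mul, invParity_mul]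
  have e : w⁻¹ * (w * cs.simple i * w⁻¹) * w⁻¹⁻¹ = cs.simple i := by group
  rw [e] at h₂ ⊢
  rw [show cs.simple i * cs.simple i * (cs.simple i)⁻¹ = cs.simple i by group, h₁]
  linear_combination -h₂

theorem isRightInversion_of_invParity {w t : W} (h : invParity cs w t = 1) :
    cs.IsRightInversion w t := by
  obtain ⟨ω, hω, rfl⟩ := cs.exists_isReduced w
  apply cs.isRightInversion_of_mem_rightInvSeq hω
  rw [invParity_wordProd] at h
  by_contra hn
  simp [List.count_eq_zero_of_not_mem hn] at h

theorem isRightInversion_iff_invParity {w t : W} (ht : cs.IsReflection t) :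
    cs.IsRightInversion w t ↔ invParity cs w t = 1 := by
  refine ⟨fun h ↦ ?_, isRightInversion_of_invParity cs⟩
  by_contra hn
  refine ht.not_isRightInversion_mul_left_iff.mpr h (isRightInversion_of_invParity cs ?_)
  rw [invParity_mul, invParity_self cs ht, show t * t * t⁻¹ = t by group]
  have : ∀ a : ZMod 2, a ≠ 1 → 1 + a = 1 := by decide
  exact this _ hn

theorem mem_leftInvSeq_of_isLeftInversion {ω : List B} {t : W}
    (h : cs.IsLeftInversion (cs.wordProd ω) t) : t ∈ cs.leftInvSeq ω := by
  rw [← cs.isRightInversion_inv_iff, isRightInversion_iff_invParity cs h.1, ← cs.wordProd_reverse,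
    invParity_wordProd] at h
  by_contra hn
  rw [List.count_eq_zero_of_not_mem (by simpa [cs.rightInvSeq_reverse] using hn)] at h
  simp at h

theorem isLeftInversion_mul_iff {u v t : W} (ht : cs.IsReflection t) :
    cs.IsLeftInversion (u * v) t ↔
      ¬ (cs.IsLeftInversion u t ↔ cs.IsLeftInversion v (u⁻¹ * t * u)) := by
  have ht' : cs.IsReflection (u⁻¹ * t * u) := by simpa using ht.conj u⁻¹
  rw [← cs.isRightInversion_inv_iff, ← cs.isRightInversion_inv_iff, ← cs.isRightInversion_inv_iff,
    isRightInversion_iff_invParity cs ht, isRightInversion_iff_invParity cs ht,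
    isRightInversion_iff_invParity cs ht', mul_inv_rev, invParity_mul, inv_inv]
  have : ∀ a b : ZMod 2, a + b = 1 ↔ ¬ (a = 1 ↔ b = 1) := by decide
  exact this _ _

theorem isLeftInversion_simple_iff {i : B} {t : W} :
    cs.IsLeftInversion (cs.simple i) t ↔ t = cs.simple i := by
  constructor
  · intro h
    rw [← cs.wordProd_singleton] at h
    simpa using mem_leftInvSeq_of_isLeftInversion cs h
  · rintro rfl
    exact ⟨cs.isReflection_simple i, by simp⟩

theorem isRightDescent_iff_isLeftInversion {w : W} {i : B} :
    cs.IsRightDescent w i ↔ cs.IsLeftInversion w (w * cs.simple i * w⁻¹) := by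
  simp [CoxeterSystem.IsLeftInversion, CoxeterSystem.IsRightDescent, cs.isReflection_simple]

theorem isLeftInversion_mul_simple_iff {y : W} {i : B} {r : W} (hr : cs.IsReflection r) :
    cs.IsLeftInversion (y * cs.simple i) r ↔
      ¬ (cs.IsLeftInversion y r ↔ r = y * cs.simple i * y⁻¹) := by
  rw [isLeftInversion_mul_iff cs hr, isLeftInversion_simple_iff]
  have : y⁻¹ * r * y = cs.simple i ↔ r = y * cs.simple i * y⁻¹ := by
    constructor
    · intro h; rw [← h]; group
    · intro h; rw [h]; group
  rw [this]

theorem isLeftInversion_mul_simple_of_isRightDescent {y : W} {i : B}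
    (hi : cs.IsRightDescent y i) {r : W} :
    cs.IsLeftInversion (y * cs.simple i) r ↔
      cs.IsLeftInversion y r ∧ r ≠ y * cs.simple i * y⁻¹ := by
  by_cases hr : cs.IsReflection r
  · rw [isLeftInversion_mul_simple_iff cs hr]
    have := (isRightDescent_iff_isLeftInversion cs).mp hi
    constructor
    · intro h
      by_cases h' : r = y * cs.simple i * y⁻¹
      · subst h'; tauto
      · tauto
    · tauto
  · exact ⟨fun h ↦ (hr h.1).elim, fun h ↦ (hr h.1.1).elim⟩

theorem isLeftInversion_inv_conj_iff {u t : W} (ht : cs.IsReflection t) :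
    cs.IsLeftInversion u⁻¹ (u⁻¹ * t * u) ↔ cs.IsLeftInversion u t := by
  have h := isLeftInversion_mul_iff cs (u := u) (v := u⁻¹) ht
  have h₁ : ¬ cs.IsLeftInversion (1 : W) t := fun h ↦ by simpa using h.2
  rw [mul_inv_cancel] at h
  tauto

/-- If `u ≠ v`, one step along a geodesic from `u` to `v` crosses a reflection on which
`u` and `v` differ. -/
theorem exists_step_toward {u v : W} (h : u ≠ v) :
    ∃ i, cs.length ((u * cs.simple i)⁻¹ * v) < cs.length (u⁻¹ * v) ∧
      (cs.IsLeftInversion v (u * cs.simple i * u⁻¹) ↔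
        ¬ cs.IsLeftInversion u (u * cs.simple i * u⁻¹)) := by
  have hne : u⁻¹ * v ≠ 1 := fun h' ↦ h (inv_mul_eq_one.mp h')
  obtain ⟨i, hi⟩ := cs.exists_leftDescent_of_ne_one hne
  refine ⟨i, by simpa [mul_assoc, CoxeterSystem.IsLeftDescent] using hi, ?_⟩
  have hr : cs.IsReflection (u * cs.simple i * u⁻¹) := (cs.isReflection_simple i).conj u
  have h₁ := isLeftInversion_mul_iff cs (u := u) (v := u⁻¹ * v) hr
  rw [mul_inv_cancel_left, show u⁻¹ * (u * cs.simple i * u⁻¹) * u = cs.simple i by group,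
    cs.isLeftInversion_simple_iff_isLeftDescent] at h₁
  tauto

theorem eq_of_isLeftInversion_iff {u v : W}
    (h : ∀ t, cs.IsLeftInversion u t ↔ cs.IsLeftInversion v t) : u = v := by
  by_contra hne
  obtain ⟨i, -, hi⟩ := exists_step_toward cs hne
  rw [h] at hi
  tauto

theorem exists_isReduced_of_forall_mem {D : Set B} (ω : List B) (hω : ∀ i ∈ ω, i ∈ D) :
    ∃ ω', cs.IsReduced ω' ∧ (∀ i ∈ ω', i ∈ D) ∧ cs.wordProd ω' = cs.wordProd ω := by
  induction ω with
  | nil => exact ⟨[], by simp [CoxeterSystem.IsReduced], by simp, rfl⟩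
  | cons i ω ih =>
    obtain ⟨ω', hr, hD, hp⟩ := ih fun j hj ↦ hω j (List.mem_cons_of_mem _ hj)
    by_cases hd : cs.IsLeftDescent (cs.wordProd ω') i
    · have hmem := mem_leftInvSeq_of_isLeftInversion cs
        ((cs.isLeftInversion_simple_iff_isLeftDescent _ _).mpr hd)
      obtain ⟨j, hj, hij⟩ := List.mem_iff_getElem.mp hmem
      have he := cs.getD_leftInvSeq_mul_wordProd ω' j
      rw [List.getD_eq_getElem _ _ hj, hij] at he
      rw [cs.length_leftInvSeq] at hj
      refine ⟨ω'.eraseIdx j, ?_, fun k hk ↦ hD k (List.mem_of_mem_eraseIdx hk), ?_⟩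
      · have h₁ := cs.isLeftDescent_iff.mp hd
        have h₂ := List.length_eraseIdx_add_one hj
        have h₃ := hr.eq
        rw [CoxeterSystem.IsReduced, ← he]
        lia
      · rw [← he, hp, cs.wordProd_cons]
    · refine ⟨i :: ω', ?_, ?_, ?_⟩
      · have h₁ := cs.not_isLeftDescent_iff.mp hd
        rw [CoxeterSystem.IsReduced, cs.wordProd_cons, h₁, hr.eq, List.length_cons]
      · intro k hk
        rcases List.mem_cons.mp hk with rfl | hk
        · exact hω _ List.mem_cons_self
        · exact hD k hk
      · rw [cs.wordProd_cons, hp, cs.wordProd_cons]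

theorem simple_mem_parab {D : Set B} {i : B} (hi : i ∈ D) : cs.simple i ∈ parab cs D :=
  Subgroup.subset_closure ⟨i, hi, rfl⟩

theorem wordProd_mem_parab {D : Set B} {ω : List B} (h : ∀ i ∈ ω, i ∈ D) :
    cs.wordProd ω ∈ parab cs D :=
  Subgroup.list_prod_mem _ fun x hx ↦ by
    obtain ⟨i, hi, rfl⟩ := List.mem_map.mp hx
    exact simple_mem_parab cs (h i hi)

theorem exists_isReduced_of_mem_parab {D : Set B} {v : W} (hv : v ∈ parab cs D) :
    ∃ ω, cs.IsReduced ω ∧ (∀ i ∈ ω, i ∈ D) ∧ cs.wordProd ω = v := by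
  obtain ⟨ω, hD, rfl⟩ : ∃ ω : List B, (∀ i ∈ ω, i ∈ D) ∧ cs.wordProd ω = v := by
    induction hv using Subgroup.closure_induction with
    | mem x hx =>
      obtain ⟨i, hi, rfl⟩ := hx
      exact ⟨[i], by simpa using hi, by simp⟩
    | one => exact ⟨[], by simp, by simp⟩
    | mul x y _ _ hx hy =>
      obtain ⟨ω, h, rfl⟩ := hx
      obtain ⟨ω', h', rfl⟩ := hy
      refine ⟨ω ++ ω', fun i hi ↦ ?_, cs.wordProd_append _ _⟩
      rcases List.mem_append.mp hi with hi | hi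
      exacts [h i hi, h' i hi]
    | inv x _ hx =>
      obtain ⟨ω, h, rfl⟩ := hx
      exact ⟨ω.reverse, by simpa using h, by simp⟩
  exact exists_isReduced_of_forall_mem cs ω hD

theorem leftInvSeq_mem_parab {D : Set B} {ω : List B} (h : ∀ i ∈ ω, i ∈ D) {t : W}
    (ht : t ∈ cs.leftInvSeq ω) : t ∈ parab cs D := by
  induction ω generalizing t with
  | nil => simp at ht
  | cons i ω ih =>
    have hi := simple_mem_parab cs (h i List.mem_cons_self)
    rw [CoxeterSystem.leftInvSeq, List.mem_cons, List.mem_map] at ht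
    rcases ht with rfl | ⟨t', ht', rfl⟩
    · exact hi
    · exact mul_mem (mul_mem hi (ih (fun j hj ↦ h j (List.mem_cons_of_mem _ hj)) ht'))
        (inv_mem hi)

theorem mem_parab_of_isLeftInversion {D : Set B} {v t : W} (hv : v ∈ parab cs D)
    (ht : cs.IsLeftInversion v t) : t ∈ parab cs D := by
  obtain ⟨ω, -, hD, rfl⟩ := exists_isReduced_of_mem_parab cs hv
  exact leftInvSeq_mem_parab cs hD (mem_leftInvSeq_of_isLeftInversion cs ht)

theorem exists_isLeftInversion_simple {D : Set B} {v t : W} (hv : v ∈ parab cs D)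
    (ht : cs.IsLeftInversion v t) : ∃ i ∈ D, cs.IsLeftInversion v (cs.simple i) := by
  obtain ⟨ω, hr, hD, rfl⟩ := exists_isReduced_of_mem_parab cs hv
  cases ω with
  | nil => exact absurd ht.2 (by simp)
  | cons i ω =>
    exact ⟨i, hD i List.mem_cons_self, cs.isLeftInversion_of_mem_leftInvSeq hr
      (by simp [CoxeterSystem.leftInvSeq])⟩

/-- Every element factors as `x * v` with `v` in the parabolic subgroup and no inversion of `x`
conjugate into the parabolic subgroup by `x`. -/
theorem exists_coset_factorization (D : Set B) (w : W) :
    ∃ x, ∃ v ∈ parab cs D, w = x * v ∧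
      ∀ t ∈ parab cs D, ¬ cs.IsLeftInversion x (x * t * x⁻¹) := by
  have hex : ∃ n, ∃ v ∈ parab cs D, cs.length (w * v⁻¹) = n := ⟨_, 1, one_mem _, rfl⟩
  obtain ⟨v, hv, hn⟩ := Nat.find_spec hex
  refine ⟨w * v⁻¹, v, hv, by group, fun t ht hinv ↦ ?_⟩
  refine Nat.find_min hex (m := cs.length (w * (t⁻¹ * v)⁻¹)) ?_
    ⟨t⁻¹ * v, mul_mem (inv_mem ht) hv, rfl⟩
  rw [← hn]
  have := hinv.2
  rwa [show w * v⁻¹ * t * (w * v⁻¹)⁻¹ * (w * v⁻¹) = w * (t⁻¹ * v)⁻¹ by group] at this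

theorem exists_parab_part (D : Set B) (u : W) :
    ∃ v ∈ parab cs D, ∀ t ∈ parab cs D, cs.IsLeftInversion v t ↔ cs.IsLeftInversion u t := by
  obtain ⟨x, v, hv, hu, hx⟩ := exists_coset_factorization cs D u⁻¹
  refine ⟨v⁻¹, inv_mem hv, fun t ht ↦ ?_⟩
  by_cases hr : cs.IsReflection t
  · rw [show u = v⁻¹ * x⁻¹ by rw [← mul_inv_rev, ← hu, inv_inv], isLeftInversion_mul_iff cs hr]
    have ht' : v⁻¹⁻¹ * t * v⁻¹ ∈ parab cs D := by
      rw [inv_inv]; exact mul_mem (mul_mem hv ht) (inv_mem hv)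
    have h := hx _ ht'
    have hr' : cs.IsReflection (x * (v⁻¹⁻¹ * t * v⁻¹) * x⁻¹) := by
      simpa using (hr.conj v).conj x
    rw [← isLeftInversion_inv_conj_iff cs hr',
      show x⁻¹ * (x * (v⁻¹⁻¹ * t * v⁻¹) * x⁻¹) * x = v⁻¹⁻¹ * t * v⁻¹ by group] at h
    tauto
  · exact ⟨fun h ↦ (hr h.1).elim, fun h ↦ (hr h.1).elim⟩

theorem exists_relative_parab_part (D : Set B) {x : W} (u : W)
    (hx : ∀ t ∈ parab cs D, ¬ cs.IsLeftInversion x (x * t * x⁻¹)) :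
    ∃ v ∈ parab cs D, ∀ t ∈ parab cs D,
      cs.IsLeftInversion v t ↔ cs.IsLeftInversion u (x * t * x⁻¹) := by
  obtain ⟨v, hv, h⟩ := exists_parab_part cs D (x⁻¹ * u)
  refine ⟨v, hv, fun t ht ↦ ?_⟩
  by_cases hr : cs.IsReflection t
  · have h' := isLeftInversion_mul_iff cs (u := x) (v := x⁻¹ * u) (hr.conj x)
    rw [mul_inv_cancel_left, show x⁻¹ * (x * t * x⁻¹) * x = t by group, ← h t ht] at h'
    have := hx t ht
    tauto
  · refine ⟨fun h ↦ (hr h.1).elim, fun h ↦ (hr ?_).elim⟩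
    simpa using h.1

theorem exists_dual_parab_part (D : Set B) {y : W} (u : W)
    (hy : ∀ t ∈ parab cs D, cs.IsReflection t → cs.IsLeftInversion y (y * t * y⁻¹)) :
    ∃ v ∈ parab cs D, ∀ t ∈ parab cs D, cs.IsReflection t →
      (cs.IsLeftInversion v t ↔ ¬ cs.IsLeftInversion u (y * t * y⁻¹)) := by
  obtain ⟨v, hv, h⟩ := exists_parab_part cs D (y⁻¹ * u)
  refine ⟨v, hv, fun t ht hr ↦ ?_⟩
  have h' := isLeftInversion_mul_iff cs (u := y) (v := y⁻¹ * u) (hr.conj y)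
  rw [mul_inv_cancel_left, show y⁻¹ * (y * t * y⁻¹) * y = t by group, ← h t ht] at h'
  have := hy t ht hr
  tauto

theorem length_eq_of_forall_isLeftDescent {D : Set B} {q : W}
    (hq : ∀ i ∈ D, cs.IsLeftDescent q i) {p : W} (hp : p ∈ parab cs D) :
    cs.length q = cs.length p + cs.length (p⁻¹ * q) := by
  obtain ⟨ω, hr, hD, rfl⟩ := exists_isReduced_of_mem_parab cs hp
  clear hp
  induction ω with
  | nil => simp
  | cons i ω ih =>
    have hr' : cs.IsReduced ω := hr.drop 1
    have ih := ih hr' fun j hj ↦ hD j (List.mem_cons_of_mem _ hj)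
    have hlen : cs.length (cs.wordProd (i :: ω)) = cs.length (cs.wordProd ω) + 1 := by
      rw [hr.eq, hr'.eq, List.length_cons]
    have h₁ : ¬ cs.IsLeftInversion (cs.wordProd ω) (cs.simple i) := by
      rw [cs.isLeftInversion_simple_iff_isLeftDescent, cs.not_isLeftDescent_iff,
        ← cs.wordProd_cons, hlen]
    have h₂ : cs.IsLeftInversion (cs.wordProd ω * ((cs.wordProd ω)⁻¹ * q)) (cs.simple i) := by
      rw [mul_inv_cancel_left, cs.isLeftInversion_simple_iff_isLeftDescent]
      exact hq i (hD i List.mem_cons_self)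
    rw [isLeftInversion_mul_iff cs (cs.isReflection_simple i)] at h₂
    have h₃ : cs.IsLeftInversion ((cs.wordProd ω)⁻¹ * q)
        ((cs.wordProd ω)⁻¹ * cs.simple i * cs.wordProd ω) := by tauto
    have h₄ := h₃.2
    rw [show (cs.wordProd ω)⁻¹ * cs.simple i * cs.wordProd ω * ((cs.wordProd ω)⁻¹ * q) =
      (cs.wordProd (i :: ω))⁻¹ * q by simp [cs.wordProd_cons, mul_assoc]] at h₄
    have h₅ := cs.length_mul_le (cs.wordProd (i :: ω)) ((cs.wordProd (i :: ω))⁻¹ * q)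
    rw [mul_inv_cancel_left] at h₅
    lia

theorem isLeftInversion_of_forall_isLeftDescent {D : Set B} {q t : W}
    (hq : ∀ i ∈ D, cs.IsLeftDescent q i) (ht : t ∈ parab cs D) (hr : cs.IsReflection t) :
    cs.IsLeftInversion q t := by
  refine ⟨hr, ?_⟩
  have h := length_eq_of_forall_isLeftDescent cs hq ht
  have := hr.odd_length.pos
  rw [hr.inv] at h
  lia

theorem isLeftInversion_conj_of_forall_isRightDescent {D : Set B} {w t : W}
    (hw : ∀ i ∈ D, cs.IsRightDescent w i) (ht : t ∈ parab cs D) (hr : cs.IsReflection t) :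
    cs.IsLeftInversion w (w * t * w⁻¹) := by
  have h := isLeftInversion_of_forall_isLeftDescent cs (q := w⁻¹)
    (fun i hi ↦ cs.isLeftDescent_inv_iff.mpr (hw i hi)) ht hr
  rw [← isLeftInversion_inv_conj_iff cs (hr.conj w)]
  simpa [mul_assoc] using h

/-- If every element of `D` is a right descent of `w = x * v`, the inversions of `w` are those of
`x` together with all reflections of the conjugated parabolic subgroup. -/
theorem isLeftInversion_iff_of_factorization {D : Set B} {w x v : W}
    (hw : ∀ i ∈ D, cs.IsRightDescent w i) (hv : v ∈ parab cs D) (hwx : w = x * v)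
    {r : W} (hr : cs.IsReflection r) :
    cs.IsLeftInversion w r ↔ cs.IsLeftInversion x r ∨ x⁻¹ * r * x ∈ parab cs D := by
  have hr' : cs.IsReflection (x⁻¹ * r * x) := by simpa using hr.conj x⁻¹
  by_cases hP : x⁻¹ * r * x ∈ parab cs D
  · simp only [hP, or_true, iff_true]
    have h := isLeftInversion_conj_of_forall_isRightDescent cs hw
      (t := v⁻¹ * (x⁻¹ * r * x) * v) (mul_mem (mul_mem (inv_mem hv) hP) hv)
      (by simpa using hr'.conj v⁻¹)
    simpa [hwx, mul_assoc] using h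
  · have h : ¬ cs.IsLeftInversion v (x⁻¹ * r * x) :=
      fun h ↦ hP (mem_parab_of_isLeftInversion cs hv h)
    rw [hwx, isLeftInversion_mul_iff cs hr]
    tauto

theorem conj_simple_mem_of_rank_two {P : Subgroup W} {x y : W} {i b : B}
    (hx : ∀ r, cs.IsLeftInversion x r → r ∉ P)
    (hy : ∀ t ∈ parab cs {i, b}, cs.IsReflection t → cs.IsLeftInversion y (y * t * y⁻¹))
    (hR : ∀ t ∈ parab cs {i, b}, cs.IsReflection t →
      cs.IsLeftInversion x (y * t * y⁻¹) ∨ y * t * y⁻¹ ∈ P)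
    {g : W} (hg : g ∈ parab cs {i, b}) (hgr : cs.IsReflection g) (hgP : y * g * y⁻¹ ∈ P)
    (hgb : g ≠ cs.simple b) : y * cs.simple i * y⁻¹ ∈ P := by
  by_contra hiP
  have hi := simple_mem_parab cs (show i ∈ ({i, b} : Set B) by simp)
  have hb := simple_mem_parab cs (show b ∈ ({i, b} : Set B) by simp)
  have hir := cs.isReflection_simple i
  have hbr := cs.isReflection_simple b
  obtain ⟨p, hp, h⟩ := exists_dual_parab_part cs {i, b} x hy
  have hpi : ¬ cs.IsLeftInversion p (cs.simple i) := by
    rw [h _ hi hir, not_not]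
    exact (hR _ hi hir).resolve_right hiP
  have hpg : cs.IsLeftInversion p g := by
    rw [h _ hg hgr]
    exact fun h' ↦ hx _ h' hgP
  have hpb : cs.IsLeftInversion p (cs.simple b) := by
    obtain ⟨d, rfl | rfl, hd⟩ := exists_isLeftInversion_simple cs hp hpg
    exacts [(hpi hd).elim, hd]
  have hbP : y * cs.simple b * y⁻¹ ∈ P :=
    (hR _ hb hbr).resolve_left ((h _ hb hbr).mp hpb)
  have hcocycle : ∀ {t}, cs.IsReflection t → (cs.IsLeftInversion p t ↔ ¬ (t = cs.simple b ↔
      cs.IsLeftInversion (cs.simple b * p) (cs.simple b * t * cs.simple b))) := by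
    intro t ht
    have := isLeftInversion_mul_iff cs (u := cs.simple b) (v := cs.simple b * p) ht
    simpa [isLeftInversion_simple_iff] using this
  have hpi' : cs.IsLeftInversion (cs.simple b * p) (cs.simple i) := by
    have hg' := (hcocycle hgr).mp hpg
    have hb' := (hcocycle hbr).mp hpb
    rw [cs.simple_mul_simple_self, one_mul] at hb'
    have hg'' : cs.IsLeftInversion (cs.simple b * p) (cs.simple b * g * cs.simple b) := by tauto
    obtain ⟨d, rfl | rfl, hd⟩ := exists_isLeftInversion_simple cs (mul_mem hb hp) hg''
    exacts [hd, by tauto]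
  have htr : cs.IsReflection (cs.simple b * cs.simple i * cs.simple b) := by
    simpa using hir.conj (cs.simple b)
  have hpt : cs.IsLeftInversion p (cs.simple b * cs.simple i * cs.simple b) := by
    have hne : cs.simple b * cs.simple i * cs.simple b ≠ cs.simple b := by
      intro h'
      rw [mul_eq_right, mul_eq_one_iff_inv_eq, cs.inv_simple] at h'
      exact hpi (h' ▸ hpb)
    rw [hcocycle htr]
    rw [show cs.simple b * (cs.simple b * cs.simple i * cs.simple b) * cs.simple b =
      cs.simple i by simp [mul_assoc]]
    tauto
  have htm := mul_mem (mul_mem hb hi) hb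
  have htP := (hR _ htm htr).resolve_left ((h _ htm htr).mp hpt)
  refine hiP ?_
  convert mul_mem (mul_mem hbP htP) hbP using 1
  simp [mul_assoc]

theorem exists_common_lower {P : Subgroup W} {x w u y : W} {i b : B}
    (hx : ∀ r, cs.IsLeftInversion x r → r ∉ P)
    (hw : ∀ r, cs.IsLeftInversion w r → cs.IsLeftInversion x r ∨ r ∈ P)
    (hyw : ∀ r, cs.IsLeftInversion y r → cs.IsLeftInversion w r)
    (huy : ∀ r, cs.IsLeftInversion u r → r ∈ P → cs.IsLeftInversion y r)
    (hi : cs.IsRightDescent y i) (hb : cs.IsRightDescent y b)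
    (hiu : cs.IsLeftInversion u (y * cs.simple i * y⁻¹) → y * cs.simple i * y⁻¹ ∉ P)
    (hbu : cs.IsLeftInversion u (y * cs.simple b * y⁻¹) → y * cs.simple b * y⁻¹ ∉ P) :
    ∃ z, (∀ r, cs.IsLeftInversion z r → cs.IsLeftInversion y r ∧
        r ≠ y * cs.simple i * y⁻¹ ∧ r ≠ y * cs.simple b * y⁻¹) ∧
      ∀ r, cs.IsLeftInversion u r → r ∈ P → cs.IsLeftInversion z r := by
  have hD : ∀ d ∈ ({i, b} : Set B), cs.IsRightDescent y d := by
    rintro d (rfl | rfl)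
    exacts [hi, hb]
  have hy : ∀ t ∈ parab cs {i, b}, cs.IsReflection t → cs.IsLeftInversion y (y * t * y⁻¹) :=
    fun t ht hr ↦ isLeftInversion_conj_of_forall_isRightDescent cs hD ht hr
  have him := simple_mem_parab cs (show i ∈ ({i, b} : Set B) by simp)
  have hbm := simple_mem_parab cs (show b ∈ ({i, b} : Set B) by simp)
  obtain ⟨z, q, hq, hyz, hz⟩ := exists_coset_factorization cs {i, b} y
  have hne : ∀ s ∈ parab cs {i, b}, ∀ r, cs.IsLeftInversion z r → r ≠ y * s * y⁻¹ := by
    rintro s hs r hr rfl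
    refine hz (q * s * q⁻¹) (mul_mem (mul_mem hq hs) (inv_mem hq)) ?_
    convert hr using 1
    rw [hyz]; group
  refine ⟨z, fun r hr ↦ ⟨?_, hne _ him r hr, hne _ hbm r hr⟩, fun r hur hrP ↦ ?_⟩
  · rw [isLeftInversion_iff_of_factorization cs hD hq hyz hr.1]
    exact Or.inl hr
  · have hyr := huy r hur hrP
    rw [isLeftInversion_iff_of_factorization cs hD hq hyz hyr.1] at hyr
    refine hyr.resolve_right fun hmem ↦ ?_
    obtain ⟨g, hg, rfl⟩ : ∃ g ∈ parab cs {i, b}, r = y * g * y⁻¹ := by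
      refine ⟨q⁻¹ * (z⁻¹ * r * z) * q, mul_mem (mul_mem (inv_mem hq) hmem) hq, ?_⟩
      rw [hyz]; group
    have hgr : cs.IsReflection g := by simpa using hur.1
    have hgi : g ≠ cs.simple i := by rintro rfl; exact hiu hur hrP
    have hgb : g ≠ cs.simple b := by rintro rfl; exact hbu hur hrP
    have hR : ∀ t ∈ parab cs {i, b}, cs.IsReflection t →
        cs.IsLeftInversion x (y * t * y⁻¹) ∨ y * t * y⁻¹ ∈ P :=
      fun t ht hr ↦ hw _ (hyw _ (hy t ht hr))
    have hiP := conj_simple_mem_of_rank_two cs hx hy hR hg hgr hrP hgb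
    have hbP : y * cs.simple b * y⁻¹ ∈ P := by
      rw [Set.pair_comm] at hy hR hg
      exact conj_simple_mem_of_rank_two cs hx hy hR hg hgr hrP hgi
    obtain ⟨p, hp, h⟩ := exists_dual_parab_part cs {i, b} u hy
    have hpg : ¬ cs.IsLeftInversion p g := by rwa [h g hg hgr, not_not]
    refine hpg (isLeftInversion_of_forall_isLeftDescent cs ?_ hg hgr)
    rintro d (rfl | rfl) <;> rw [← cs.isLeftInversion_simple_iff_isLeftDescent]
    · rw [h _ him (cs.isReflection_simple _)]
      exact fun h' ↦ hiu h' hiP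
    · rw [h _ hbm (cs.isReflection_simple _)]
      exact fun h' ↦ hbu h' hbP

/-- Let `w` have inversions among those of `x` and the elements of `P`, where `P` contains no
inversion of `x`. An element `u` below `w` in the weak order all of whose cover reflections lie
in `P` is the least element of those below `w` that contain the inversions of `u` in `P`. -/
theorem isLeftInversion_mono_of_coverReflection_mem {P : Subgroup W} {x w u u' : W}
    (hx : ∀ r, cs.IsLeftInversion x r → r ∉ P)
    (hw : ∀ r, cs.IsLeftInversion w r → cs.IsLeftInversion x r ∨ r ∈ P)
    (huw : ∀ r, cs.IsLeftInversion u r → cs.IsLeftInversion w r)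
    (huP : ∀ i, cs.IsRightDescent u i → u * cs.simple i * u⁻¹ ∈ P)
    (huw' : ∀ r, cs.IsLeftInversion u' r → cs.IsLeftInversion w r)
    (huu' : ∀ r, cs.IsLeftInversion u r → r ∈ P → cs.IsLeftInversion u' r) :
    ∀ r, cs.IsLeftInversion u r → cs.IsLeftInversion u' r := by
  have lower : ∀ n, ∀ y, cs.length y = n →
      (∀ r, cs.IsLeftInversion y r → cs.IsLeftInversion w r) →
      (∀ r, cs.IsLeftInversion u r → cs.IsLeftInversion y r) →
      ∀ z, (∀ r, cs.IsLeftInversion u r → r ∈ P → cs.IsLeftInversion z r) →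
      (∀ r, cs.IsLeftInversion z r → cs.IsLeftInversion y r) →
      ∀ r, cs.IsLeftInversion u r → cs.IsLeftInversion z r := by
    intro n
    induction n using Nat.strong_induction_on with
    | _ n ih =>
    intro y hn hyw huy z huz hzy
    have step : ∀ v, (∀ r, cs.IsLeftInversion v r → cs.IsLeftInversion y r) → v ≠ y →
        ∃ i, cs.IsRightDescent y i ∧ ¬ cs.IsLeftInversion v (y * cs.simple i * y⁻¹) ∧
          ∀ r, cs.IsLeftInversion v r → cs.IsLeftInversion (y * cs.simple i) r := by
      intro v hv hne
      obtain ⟨i, -, hi⟩ := exists_step_toward cs hne.symm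
      have hi' := hv (y * cs.simple i * y⁻¹)
      have hvi : ¬ cs.IsLeftInversion v (y * cs.simple i * y⁻¹) := by tauto
      have hyi : cs.IsRightDescent y i := by
        rw [isRightDescent_iff_isLeftInversion]; tauto
      refine ⟨i, hyi, hvi, fun r hr ↦ ?_⟩
      rw [isLeftInversion_mul_simple_of_isRightDescent cs hyi]
      exact ⟨hv r hr, fun h ↦ hvi (h ▸ hr)⟩
    have below : ∀ {i}, cs.IsRightDescent y i → ∀ r,
        cs.IsLeftInversion (y * cs.simple i) r → cs.IsLeftInversion w r := by
      intro i hi r hr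
      rw [isLeftInversion_mul_simple_of_isRightDescent cs hi] at hr
      exact hyw r hr.1
    by_cases hzy' : z = y
    · rwa [hzy']
    obtain ⟨i, hi, hzi, hzi'⟩ := step z hzy hzy'
    refine ih _ (hn ▸ hi) (y * cs.simple i) rfl (below hi) ?_ z huz hzi'
    have huy' : u ≠ y := by
      rintro rfl
      exact hzi (huz _ ((isRightDescent_iff_isLeftInversion cs).mp hi) (huP i hi))
    obtain ⟨b, hb, hub, hub'⟩ := step u huy huy'
    obtain ⟨z', hz', huz'⟩ := exists_common_lower cs hx hw hyw (fun r hr _ ↦ huy r hr) hi hb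
      (fun h hP ↦ hzi (huz _ h hP)) (fun h _ ↦ hub h)
    have h := ih _ (hn ▸ hb) (y * cs.simple b) rfl (below hb) hub' z' huz' fun r hr ↦ by
      rw [isLeftInversion_mul_simple_of_isRightDescent cs hb]
      exact ⟨(hz' r hr).1, (hz' r hr).2.2⟩
    intro r hr
    rw [isLeftInversion_mul_simple_of_isRightDescent cs hi]
    exact ⟨(hz' r (h r hr)).1, (hz' r (h r hr)).2.1⟩
  have connected : ∀ n, ∀ y, cs.length (y⁻¹ * u') = n →
      (∀ r, cs.IsLeftInversion y r → cs.IsLeftInversion w r) →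
      (∀ r, cs.IsLeftInversion u r → cs.IsLeftInversion y r) →
      ∀ r, cs.IsLeftInversion u r → cs.IsLeftInversion u' r := by
    intro n
    induction n using Nat.strong_induction_on with
    | _ n ih =>
    intro y hn hyw huy
    by_cases hyu : y = u'
    · rwa [← hyu]
    obtain ⟨i, hlen, hi⟩ := exists_step_toward cs hyu
    by_cases hd : cs.IsRightDescent y i
    · have hyi := (isRightDescent_iff_isLeftInversion cs).mp hd
      have hsub : ∀ r, cs.IsLeftInversion (y * cs.simple i) r → cs.IsLeftInversion y r :=
        fun r hr ↦ ((isLeftInversion_mul_simple_of_isRightDescent cs hd).mp hr).1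
      refine ih _ (hn ▸ hlen) _ rfl (fun r hr ↦ hyw r (hsub r hr)) ?_
      refine lower _ y rfl hyw huy _ (fun r hr hP ↦ ?_) hsub
      rw [isLeftInversion_mul_simple_of_isRightDescent cs hd]
      refine ⟨huy r hr, ?_⟩
      rintro rfl
      exact hi.mp (huu' _ hr hP) hyi
    · have hyi : ¬ cs.IsLeftInversion y (y * cs.simple i * y⁻¹) := by
        rwa [← isRightDescent_iff_isLeftInversion]
      refine ih _ (hn ▸ hlen) _ rfl (fun r hr ↦ ?_) (fun r hr ↦ ?_)
      · rw [isLeftInversion_mul_simple_iff cs hr.1] at hr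
        by_cases h : r = y * cs.simple i * y⁻¹
        · subst h
          exact huw' _ (hi.mpr hyi)
        · exact hyw r (by tauto)
      · rw [isLeftInversion_mul_simple_iff cs hr.1]
        have h₁ := huy r hr
        have h₂ : r ≠ y * cs.simple i * y⁻¹ := by rintro rfl; exact hyi h₁
        tauto
  exact connected _ u rfl huw fun _ h ↦ h

/-- The element `x` factors the lower interval of `w` in the shard order through `W_D`: the left
inversions of `w` are those of `x` together with the reflections in `x W_D x⁻¹`, this union is
disjoint, and `x W_D x⁻¹` is generated by the cover reflections of `w`. -/
structure IsShardFactorization (w : W) (D : Set B) (x : W) : Prop where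
  isLeftInversion_iff : ∀ r, cs.IsReflection r →
    (cs.IsLeftInversion w r ↔ cs.IsLeftInversion x r ∨ x⁻¹ * r * x ∈ parab cs D)
  not_isLeftInversion : ∀ t ∈ parab cs D, ¬ cs.IsLeftInversion x (x * t * x⁻¹)
  mem_descConj_iff : ∀ r, r ∈ descConj cs w ↔ x⁻¹ * r * x ∈ parab cs D

/-- The element `v` of `W_D` has as its left inversions those `t` in `W_D` whose conjugate
`x t x⁻¹` is a left inversion of `u`. -/
def IsProjection (D : Set B) (x u v : W) : Prop :=
  v ∈ parab cs D ∧ ∀ t ∈ parab cs D, cs.IsLeftInversion v t ↔ cs.IsLeftInversion u (x * t * x⁻¹)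

theorem descConj_eq_map (w : W) :
    descConj cs w = (parab cs {i | cs.IsRightDescent w i}).map (MulAut.conj w).toMonoidHom := by
  rw [descConj, parab, MonoidHom.map_closure]
  congr 1
  ext r
  simp only [Set.mem_ofPred_eq, Set.mem_image, exists_exists_and_eq_and]
  simp [eq_comm]

theorem exists_isShardFactorization (w : W) :
    ∃ x, IsShardFactorization cs w {i | cs.IsRightDescent w i} x := by
  obtain ⟨x, v, hv, hwx, hx⟩ := exists_coset_factorization cs {i | cs.IsRightDescent w i} w
  refine ⟨x, fun r hr ↦ isLeftInversion_iff_of_factorization cs (fun i hi ↦ hi) hv hwx hr, hx,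
    fun r ↦ ?_⟩
  rw [descConj_eq_map]
  generalize parab cs {i | cs.IsRightDescent w i} = H at hv ⊢
  subst hwx
  constructor
  · rintro ⟨t, ht, rfl⟩
    convert mul_mem (mul_mem hv ht) (inv_mem hv) using 1
    simp [mul_assoc]
  · intro h
    exact ⟨v⁻¹ * (x⁻¹ * r * x) * v, mul_mem (mul_mem (inv_mem hv) h) hv, by simp [mul_assoc]⟩

variable {cs}

theorem IsProjection.eq {D : Set B} {x u v v' : W} (h : IsProjection cs D x u v)
    (h' : IsProjection cs D x u v') : v = v' := by
  refine eq_of_isLeftInversion_iff cs fun t ↦ ?_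
  by_cases ht : t ∈ parab cs D
  · rw [h.2 t ht, h'.2 t ht]
  · exact iff_of_false (fun hv ↦ ht (mem_parab_of_isLeftInversion cs h.1 hv))
      fun hv ↦ ht (mem_parab_of_isLeftInversion cs h'.1 hv)

namespace IsShardFactorization

variable {w x : W} {D : Set B}

theorem exists_isProjection (h : IsShardFactorization cs w D x) (u : W) :
    ∃ v, IsProjection cs D x u v := by
  obtain ⟨v, hv, hvu⟩ := exists_relative_parab_part cs D u h.not_isLeftInversion
  exact ⟨v, hv, hvu⟩

theorem conj_mem_descConj_iff (h : IsShardFactorization cs w D x) {t : W} :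
    x * t * x⁻¹ ∈ descConj cs w ↔ t ∈ parab cs D := by
  rw [h.mem_descConj_iff]
  simp [mul_assoc]

theorem invSet_subset_of_isProjection (h : IsShardFactorization cs w D x) {u u' v v' : W}
    (hu : shardLE cs u w) (hu' : invSet cs u' ⊆ invSet cs w) (huv : IsProjection cs D x u v)
    (huv' : IsProjection cs D x u' v') (hv : invSet cs v ⊆ invSet cs v') :
    invSet cs u ⊆ invSet cs u' := by
  refine isLeftInversion_mono_of_coverReflection_mem cs (P := descConj cs w) (x := x) (w := w)
    ?_ ?_ hu.1 (fun i hi ↦ hu.2 (Subgroup.subset_closure ⟨i, hi, rfl⟩)) hu' ?_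
  · intro r hr hrP
    refine h.not_isLeftInversion _ ((h.mem_descConj_iff r).mp hrP) ?_
    simpa [mul_assoc] using hr
  · intro r hr
    rw [h.mem_descConj_iff]
    exact (h.isLeftInversion_iff r hr.1).mp hr
  · intro r hr hrP
    obtain ⟨t, rfl⟩ : ∃ t, r = x * t * x⁻¹ := ⟨x⁻¹ * r * x, by group⟩
    rw [h.conj_mem_descConj_iff] at hrP
    rw [← huv'.2 t hrP]
    exact hv ((huv.2 t hrP).mpr hr)

theorem exists_shardLE_isProjection (h : IsShardFactorization cs w D x) {v : W}
    (hv : v ∈ parab cs D) : ∃ u, shardLE cs u w ∧ IsProjection cs D x u v := by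
  have hex : ∃ n, ∃ y, cs.length y = n ∧ invSet cs y ⊆ invSet cs w ∧
      IsProjection cs D x y v := by
    refine ⟨_, x * v, rfl, fun r hr ↦ ?_, hv, fun t ht ↦ ?_⟩
    · have hr' := (isLeftInversion_mul_iff cs hr.1).mp hr
      refine (h.isLeftInversion_iff r hr.1).mpr ?_
      have := mem_parab_of_isLeftInversion cs hv (t := x⁻¹ * r * x)
      tauto
    · by_cases hr : cs.IsReflection t
      · have := isLeftInversion_mul_iff cs (u := x) (v := v) (hr.conj x)
        rw [this, show x⁻¹ * (x * t * x⁻¹) * x = t by group]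
        have := h.not_isLeftInversion t ht
        tauto
      · exact iff_of_false (fun h' ↦ hr h'.1) fun h' ↦ hr (by simpa using h'.1)
  obtain ⟨y, hn, hyw, hyv⟩ := Nat.find_spec hex
  refine ⟨y, ⟨hyw, ?_⟩, hyv⟩
  rw [descConj, Subgroup.closure_le]
  rintro _ ⟨i, hi, rfl⟩
  by_contra hP
  refine Nat.find_min hex (m := cs.length (y * cs.simple i)) (hn ▸ hi)
    ⟨_, rfl, fun r hr ↦ hyw ?_, hyv.1, fun t ht ↦ ?_⟩
  · exact ((isLeftInversion_mul_simple_of_isRightDescent cs hi).mp hr).1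
  · rw [isLeftInversion_mul_simple_of_isRightDescent cs hi, hyv.2 t ht]
    refine (and_iff_left ?_).symm
    intro h'
    refine hP ?_
    rw [← h']
    exact h.conj_mem_descConj_iff.mpr ht

theorem isCoverReflection_iff (h : IsShardFactorization cs w D x) {u v t : W}
    (hu : shardLE cs u w) (huv : IsProjection cs D x u v) (ht : t ∈ parab cs D) :
    (∃ i, cs.IsRightDescent v i ∧ t = v * cs.simple i * v⁻¹) ↔
      ∃ i, cs.IsRightDescent u i ∧ x * t * x⁻¹ = u * cs.simple i * u⁻¹ := by
  constructor
  · rintro ⟨j, hj, rfl⟩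
    set t := v * cs.simple j * v⁻¹
    have hjt : cs.IsLeftInversion v t := (isRightDescent_iff_isLeftInversion cs).mp hj
    have hv' : v * cs.simple j ∈ parab cs D := by
      simpa [t] using mul_mem ht huv.1
    obtain ⟨u', hu', huv'⟩ := h.exists_shardLE_isProjection hv'
    have hiff : ∀ r, cs.IsLeftInversion (v * cs.simple j) r ↔ cs.IsLeftInversion v r ∧ r ≠ t :=
      fun r ↦ isLeftInversion_mul_simple_of_isRightDescent cs hj
    have hsub := h.invSet_subset_of_isProjection hu' hu.1 huv' huv fun r hr ↦ ((hiff r).mp hr).1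
    have hne : u ≠ u' := by
      rintro rfl
      have := huv.eq huv'
      exact ((hiff t).mp (this ▸ hjt)).2 rfl
    obtain ⟨i, -, hi⟩ := exists_step_toward cs hne
    have hi' := @hsub (u * cs.simple i * u⁻¹)
    simp only [invSet, Set.mem_ofPred_eq] at hi'
    have hui : cs.IsLeftInversion u (u * cs.simple i * u⁻¹) := by tauto
    have hui' : ¬ cs.IsLeftInversion u' (u * cs.simple i * u⁻¹) := by tauto
    have hd := (isRightDescent_iff_isLeftInversion cs).mpr hui
    refine ⟨i, hd, ?_⟩
    have hP : u * cs.simple i * u⁻¹ ∈ descConj cs w :=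
      hu.2 (Subgroup.subset_closure ⟨i, hd, rfl⟩)
    generalize u * cs.simple i * u⁻¹ = r at hui hui' hP
    obtain ⟨t', rfl⟩ : ∃ t', r = x * t' * x⁻¹ := ⟨x⁻¹ * r * x, by group⟩
    rw [h.conj_mem_descConj_iff] at hP
    rw [← huv.2 t' hP] at hui
    rw [← huv'.2 t' hP, hiff] at hui'
    rw [show t' = t by tauto]
  · rintro ⟨i, hi, hti⟩
    obtain ⟨v', hv'⟩ := h.exists_isProjection (u * cs.simple i)
    have hiff : ∀ t' ∈ parab cs D,
        (cs.IsLeftInversion v' t' ↔ cs.IsLeftInversion v t' ∧ t' ≠ t) := by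
      intro t' ht'
      rw [hv'.2 t' ht', isLeftInversion_mul_simple_of_isRightDescent cs hi, huv.2 t' ht', ← hti]
      simp
    have hvt : cs.IsLeftInversion v t := by
      rw [huv.2 t ht, hti]
      exact (isRightDescent_iff_isLeftInversion cs).mp hi
    have hne : v ≠ v' := by
      rintro rfl
      exact ((hiff t ht).mp hvt).2 rfl
    obtain ⟨j, -, hj⟩ := exists_step_toward cs hne
    have hmem : v * cs.simple j * v⁻¹ ∈ parab cs D := by
      by_cases hvj : cs.IsLeftInversion v (v * cs.simple j * v⁻¹)
      · exact mem_parab_of_isLeftInversion cs huv.1 hvj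
      · exact mem_parab_of_isLeftInversion cs hv'.1 (hj.mpr hvj)
    have := hiff _ hmem
    refine ⟨j, (isRightDescent_iff_isLeftInversion cs).mpr (by tauto), ?_⟩
    by_contra hne'
    exact (by tauto : ¬ (v * cs.simple j * v⁻¹ ≠ t)) fun h' ↦ hne' h'.symm

theorem descConj_eq_map_conj (h : IsShardFactorization cs w D x) {u v : W}
    (hu : shardLE cs u w) (huv : IsProjection cs D x u v) :
    descConj cs u = (descConj cs v).map (MulAut.conj x).toMonoidHom := by
  rw [descConj, descConj, MonoidHom.map_closure]
  congr 1
  ext r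
  constructor
  · rintro ⟨i, hi, rfl⟩
    have hP := hu.2 (Subgroup.subset_closure ⟨i, hi, rfl⟩)
    rw [h.mem_descConj_iff] at hP
    exact ⟨_, (h.isCoverReflection_iff hu huv hP).mpr ⟨i, hi, by group⟩, by simp [mul_assoc]⟩
  · rintro ⟨t, ⟨j, hj, rfl⟩, rfl⟩
    exact (h.isCoverReflection_iff hu huv (mem_parab_of_isLeftInversion cs huv.1
      ((isRightDescent_iff_isLeftInversion cs).mp hj))).mp ⟨j, hj, rfl⟩

theorem shardLE_iff (h : IsShardFactorization cs w D x) {a b va vb : W}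
    (ha : shardLE cs a w) (hb : shardLE cs b w) (hva : IsProjection cs D x a va)
    (hvb : IsProjection cs D x b vb) : shardLE cs a b ↔ shardLE cs va vb := by
  refine and_congr ⟨fun hab t ht ↦ ?_, h.invSet_subset_of_isProjection ha hb.1 hva hvb⟩ ?_
  · have htD := mem_parab_of_isLeftInversion cs hva.1 ht
    exact (hvb.2 t htD).mpr (hab ((hva.2 t htD).mp ht))
  · rw [h.descConj_eq_map_conj ha hva, h.descConj_eq_map_conj hb hvb]
    exact Subgroup.map_le_map_iff_of_injective (MulAut.conj x).injective

end IsShardFactorization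

variable (cs)

theorem shardLE_refl (u : W) : shardLE cs u u := ⟨subset_rfl, le_rfl⟩

variable {cs} in
theorem shardLE.trans {u v w : W} (huv : shardLE cs u v) (hvw : shardLE cs v w) :
    shardLE cs u w := ⟨huv.1.trans hvw.1, huv.2.trans hvw.2⟩

theorem shardLE_antisymm {u v : W} (huv : shardLE cs u v) (hvu : shardLE cs v u) : u = v :=
  eq_of_isLeftInversion_iff cs fun _ ↦ ⟨fun h ↦ huv.1 h, fun h ↦ hvu.1 h⟩

/-- The lower interval of `w` in the shard order is isomorphic to the shard order on the
parabolic subgroup generated by the right descents of `w`. -/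
theorem exists_equiv_parab (w : W) :
    ∃ e : {u // shardLE cs u w} ≃ {v // v ∈ parab cs {i | cs.IsRightDescent w i}},
      ∀ a b : {u // shardLE cs u w},
        shardLE cs (a : W) b ↔ shardLE cs (e a : W) (e b) := by
  obtain ⟨x, h⟩ := exists_isShardFactorization cs w
  choose f hf using h.exists_isProjection
  refine ⟨Equiv.ofBijective (fun u ↦ ⟨f u, (hf u).1⟩) ⟨fun a b hab ↦ ?_, fun v ↦ ?_⟩,
    fun a b ↦ h.shardLE_iff a.2 b.2 (hf a) (hf b)⟩
  · have hab' : f a = f b := congrArg Subtype.val hab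
    refine Subtype.ext (shardLE_antisymm cs ?_ ?_)
    · rw [h.shardLE_iff a.2 b.2 (hf _) (hf _), hab']
      exact shardLE_refl cs _
    · rw [h.shardLE_iff b.2 a.2 (hf _) (hf _), hab']
      exact shardLE_refl cs _
  · obtain ⟨u, hu, huv⟩ := h.exists_shardLE_isProjection v.2
    exact ⟨⟨u, hu⟩, Subtype.ext ((hf u).eq huv)⟩

theorem mem_parab_of_shardLE {D : Set B} {a b : W} (hab : shardLE cs a b)
    (hb : b ∈ parab cs D) : a ∈ parab cs D := by
  obtain ⟨v, hv, hva⟩ := exists_parab_part cs D a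
  rwa [eq_of_isLeftInversion_iff cs (u := a) (v := v)]
  refine fun t ↦ ⟨fun h ↦ ?_, fun h ↦ ?_⟩
  · exact (hva t (mem_parab_of_isLeftInversion cs hb (hab.1 h))).mpr h
  · exact (hva t (mem_parab_of_isLeftInversion cs hv h)).mp h

theorem exists_simple_eq_of_simple_mem_parab {D : Set B} {i : B}
    (hi : cs.simple i ∈ parab cs D) : ∃ d ∈ D, cs.simple d = cs.simple i := by
  obtain ⟨d, hd, h⟩ := exists_isLeftInversion_simple cs hi
    ((isLeftInversion_simple_iff cs).mpr rfl)
  exact ⟨d, hd, (isLeftInversion_simple_iff cs).mp h⟩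

theorem simple_mem_parab_of_mem_supp {D : Set B} {v : W} {i : B} (hv : v ∈ parab cs D)
    (hi : i ∈ supp cs v) : cs.simple i ∈ parab cs D := by
  obtain ⟨l, hl, rfl, hil⟩ := hi
  induction l with
  | nil => simp at hil
  | cons j l ih =>
    have hj : cs.simple j ∈ parab cs D := by
      refine mem_parab_of_isLeftInversion cs hv (cs.isLeftInversion_of_mem_leftInvSeq hl ?_)
      simp [CoxeterSystem.leftInvSeq]
    rcases List.mem_cons.mp hil with rfl | hil
    · exact hj
    · refine ih (hl.drop 1) hil ?_
      rwa [cs.wordProd_cons, Subgroup.mul_mem_cancel_left _ hj] at hv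

theorem mem_parab_setOf_isRightDescent_iff {v w : W} :
    v ∈ parab cs {i | cs.IsRightDescent w i} ↔ supp cs v ⊆ {i | cs.IsRightDescent w i} := by
  constructor
  · intro hv i hi
    obtain ⟨d, hd, h⟩ := exists_simple_eq_of_simple_mem_parab cs
      (simple_mem_parab_of_mem_supp cs hv hi)
    simp only [Set.mem_ofPred_eq, CoxeterSystem.IsRightDescent] at hd ⊢
    rwa [← h]
  · intro h
    obtain ⟨l, hl, rfl⟩ := cs.exists_isReduced v
    exact wordProd_mem_parab cs fun i hi ↦ h ⟨l, hl, rfl, hi⟩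

theorem mem_parab_supp (w : W) : w ∈ parab cs (supp cs w) := by
  obtain ⟨l, hl, rfl⟩ := cs.exists_isReduced w
  exact wordProd_mem_parab cs fun i hi ↦ ⟨l, hl, rfl, hi⟩

theorem mem_supp_of_isRightDescent {w : W} {i : B} (hi : cs.IsRightDescent w i) :
    i ∈ supp cs w := by
  obtain ⟨l, hl, hw⟩ := cs.exists_isReduced (w * cs.simple i)
  have hprod : cs.wordProd (l ++ [i]) = w := by
    simp [CoxeterSystem.wordProd_append, ← hw]
  refine ⟨l ++ [i], ?_, hprod, by simp⟩
  rw [cs.isRightDescent_iff] at hi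
  rw [CoxeterSystem.IsReduced, hprod, List.length_append, ← hl.eq, ← hw, ← hi]
  rfl

theorem mem_Es_iff {I J : Set B} {w : W} :
    w ∈ Es cs I J ↔ supp cs w = J ∧ I ⊆ {i | cs.IsRightDescent w i} := by
  constructor
  · exact fun h ↦ ⟨h.2.1, h.2.2.1⟩
  · rintro ⟨rfl, hI⟩
    exact ⟨mem_parab_supp cs w, rfl, hI, fun i ↦ mem_supp_of_isRightDescent cs⟩

theorem nat_card_chains_below (w : W) (k : ℕ) :
    Nat.card {c : Fin (k + 1) → W //
        (∀ i j, i ≤ j → shardLE cs (c i) (c j)) ∧ shardLE cs (c (Fin.last k)) w} =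
      Nat.card {c : Fin (k + 1) → W // (∀ i j, i ≤ j → shardLE cs (c i) (c j)) ∧
        supp cs (c (Fin.last k)) ⊆ {i | cs.IsRightDescent w i}} := by
  obtain ⟨e, he⟩ := exists_equiv_parab cs w
  have below : ∀ c : {c : Fin (k + 1) → W //
      (∀ i j, i ≤ j → shardLE cs (c i) (c j)) ∧ shardLE cs (c (Fin.last k)) w},
      ∀ i, shardLE cs (c.1 i) w := fun c i ↦ (c.2.1 i _ (Fin.le_last i)).trans c.2.2
  have below' : ∀ c : {c : Fin (k + 1) → W // (∀ i j, i ≤ j → shardLE cs (c i) (c j)) ∧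
      supp cs (c (Fin.last k)) ⊆ {i | cs.IsRightDescent w i}},
      ∀ i, c.1 i ∈ parab cs {i | cs.IsRightDescent w i} := fun c i ↦
    mem_parab_of_shardLE cs (c.2.1 i _ (Fin.le_last i))
      ((mem_parab_setOf_isRightDescent_iff cs).mpr c.2.2)
  exact Nat.card_congr
    { toFun := fun c ↦ ⟨fun i ↦ (e ⟨c.1 i, below c i⟩).1,
        fun i j hij ↦ (he ⟨_, below c i⟩ ⟨_, below c j⟩).mp (c.2.1 i j hij),
        (mem_parab_setOf_isRightDescent_iff cs).mp (Subtype.prop _)⟩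
      invFun := fun c ↦ ⟨fun i ↦ (e.symm ⟨c.1 i, below' c i⟩).1,
        fun i j hij ↦ (he _ _).mpr (by simpa using c.2.1 i j hij), (e.symm _).2⟩
      left_inv := fun c ↦ by simp
      right_inv := fun c ↦ by simp }

/-- Splitting off the top element of a chain. -/
def chainSnocEquiv (k : ℕ) (J : Set B) :
    {c : Fin (k + 1 + 1) → W //
      (∀ i j, i ≤ j → shardLE cs (c i) (c j)) ∧ supp cs (c (Fin.last (k + 1))) = J} ≃
    Σ w : {w // supp cs w = J}, {c : Fin (k + 1) → W //
      (∀ i j, i ≤ j → shardLE cs (c i) (c j)) ∧ shardLE cs (c (Fin.last k)) w} where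
  toFun c := ⟨⟨c.1 (Fin.last _), c.2.2⟩, fun i ↦ c.1 i.castSucc,
    fun i j hij ↦ c.2.1 _ _ (Fin.castSucc_le_castSucc_iff.mpr hij), c.2.1 _ _ (Fin.le_last _)⟩
  invFun p := ⟨Fin.snoc p.2.1 p.1.1, by
    refine ⟨fun i j ↦ ?_, by simpa using p.1.2⟩
    induction j using Fin.lastCases with
    | last =>
      intro _
      induction i using Fin.lastCases with
      | last => exact shardLE_refl cs _
      | cast i => simpa using (p.2.2.1 i _ (Fin.le_last i)).trans p.2.2.2
    | cast j =>
      induction i using Fin.lastCases with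
      | last => intro h; exact absurd h (by simp)
      | cast i => intro h; simpa using p.2.2.1 i j (Fin.castSucc_le_castSucc_iff.mp h)⟩
  left_inv c := Subtype.ext (Fin.snoc_init_self c.1)
  right_inv p := by
    have ext : ∀ q r : Σ w : {w // supp cs w = J}, {c : Fin (k + 1) → W //
        (∀ i j, i ≤ j → shardLE cs (c i) (c j)) ∧ shardLE cs (c (Fin.last k)) w},
        q.1 = r.1 → q.2.1 = r.2.1 → q = r := by
      rintro ⟨w, c, hc⟩ ⟨_, _, hc'⟩ rfl rfl
      rfl
    exact ext _ _ (Subtype.ext (by simp)) (by simp)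

theorem nat_card_chains_supp_subset [Finite W] {J : Finset B} {w : W}
    (hw : supp cs w = (J : Set B)) (k : ℕ) :
    Nat.card {c : Fin (k + 1) → W // (∀ i j, i ≤ j → shardLE cs (c i) (c j)) ∧
        supp cs (c (Fin.last k)) ⊆ {i | cs.IsRightDescent w i}} =
      ∑ I ∈ J.powerset, if (I : Set B) ⊆ {i | cs.IsRightDescent w i} then
        nchainsTop cs (shardLE cs) k (I : Set B) else 0 := by
  have := Fintype.ofFinite W
  simp only [nchainsTop, Nat.card_eq_fintype_card, Fintype.card_subtype]
  rw [Finset.card_eq_sum_card_fiberwise (t := J.powerset)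
    (f := fun c ↦ J.filter (· ∈ supp cs (c (Fin.last k)))) fun c _ ↦ 
      Finset.mem_coe.mpr (Finset.mem_powerset.mpr (Finset.filter_subset _ J))]
  refine Finset.sum_congr rfl fun I hI ↦ ?_
  have key : ∀ s : Set B, (s ⊆ {i | cs.IsRightDescent w i} ∧ J.filter (· ∈ s) = I) ↔
      s = (I : Set B) ∧ (I : Set B) ⊆ {i | cs.IsRightDescent w i} := by
    intro s
    constructor
    · rintro ⟨hs, rfl⟩
      have hsJ : s = ((J.filter (· ∈ s) : Finset B) : Set B) := by
        ext i
        have : i ∈ s → i ∈ (J : Set B) := fun hi ↦ hw ▸ mem_supp_of_isRightDescent cs (hs hi)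
        simpa using this
      exact ⟨hsJ, hsJ ▸ hs⟩
    · rintro ⟨rfl, hs⟩
      refine ⟨hs, ?_⟩
      ext i
      simpa using fun hi ↦ Finset.mem_powerset.mp hI hi
  rw [Finset.filter_filter]
  simp only [and_assoc, key]
  split_ifs with h <;> simp [h]

/-- Recursion for chain numbers in the shard order: for `k ≥ 2`,
`N_σ(J,k) = Σ_{I ⊆ J} #E_σ(I,J) · N_σ(I,k−1)`.  (Here `nchainsTop cs r m` counts
`(m+1)`-chains, so `m + 2`-chains for `m ≥ 0` range over all `k ≥ 2`.) -/
theorem shard_chain_recursion [Finite W] [DecidableEq B] (k : ℕ) (J : Finset B) :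
    nchainsTop cs (shardLE cs) (k + 1) (J : Set B) =
      ∑ I ∈ J.powerset, Nat.card (Es cs (I : Set B) (J : Set B)) *
        nchainsTop cs (shardLE cs) k (I : Set B) := by
  have := Fintype.ofFinite W
  rw [nchainsTop, Nat.card_congr (chainSnocEquiv cs k _), Nat.card_sigma]
  simp_rw [fun w : {w // supp cs w = (J : Set B)} ↦
    (nat_card_chains_below cs w.1 k).trans (nat_card_chains_supp_subset cs w.2 k)]
  rw [Finset.sum_comm]
  refine Finset.sum_congr rfl fun I _ ↦ ?_
  rw [← Finset.sum_filter, Finset.sum_const, smul_eq_mul]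
  congr 1
  rw [← Fintype.card_subtype, ← Nat.card_eq_fintype_card]
  refine Nat.card_congr ((Equiv.subtypeSubtypeEquivSubtypeInter _ fun w ↦
    (I : Set B) ⊆ {i | cs.IsRightDescent w i}).trans
      (Equiv.subtypeEquivRight fun w ↦ (mem_Es_iff cs).symm))

end ShardBHZ
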